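/- Let a and r be positive integers with a ≥ 2 and gcd(a, r) = 1. Then 6a·∑_{l=1}^{a−1} ⌊lr/a⌋² ≥ (r−1)²(a−1)(2a−1). -/

import Mathlib

theorem six_mul_sum_Icc_sq (a : ℤ) (ha : 1 ≤ a) :
    6 * ∑ l ∈ Finset.Icc (1 : ℤ) (a - 1), l ^ 2 = (a - 1) * a * (2 * a - 1) := by
  induction a, ha using Int.leInduction with
  | base => simp
  | succ n hn ih =>
    have h : Finset.Icc (1 : ℤ) (n + 1 - 1) = insert n (Finset.Icc (1 : ℤ) (n - 1)) := by
      ext x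
      simp only [Finset.mem_Icc, Finset.mem_insert]
      omega
    rw [h, Finset.sum_insert (by simp), mul_add, ih]
    ring

/-- Multiplication by a unit modulo `a` permutes the nonzero residues. -/
theorem sum_Icc_mul_emod {M : Type*} [AddCommMonoid M] (a r : ℤ) (ha : 1 ≤ a)
    (h : IsCoprime a r) (f : ℤ → M) :
    ∑ l ∈ Finset.Icc (1 : ℤ) (a - 1), f (l * r % a) = ∑ l ∈ Finset.Icc (1 : ℤ) (a - 1), f l := by
  have hmaps : Set.MapsTo (fun l : ℤ => l * r % a) (Finset.Icc (1 : ℤ) (a - 1))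
      (Finset.Icc (1 : ℤ) (a - 1)) := by
    intro l hl
    simp only [Finset.coe_Icc, Set.mem_Icc] at hl ⊢
    have h0 := Int.emod_nonneg (l * r) (show a ≠ 0 by omega)
    have h1 := Int.emod_lt_of_pos (l * r) (show 0 < a by omega)
    have h2 : l * r % a ≠ 0 := fun h2 => by
      have h3 := h.dvd_of_dvd_mul_right (Int.dvd_of_emod_eq_zero h2)
      have h4 := Int.le_of_dvd (by omega) h3
      omega
    omega
  have hinj : Set.InjOn (fun l : ℤ => l * r % a) (Finset.Icc (1 : ℤ) (a - 1)) := by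
    intro x hx y hy hxy
    simp only [Finset.coe_Icc, Set.mem_Icc] at hx hy hxy
    have h1 : a ∣ (x - y) * r := by
      rw [sub_mul]
      exact Int.dvd_of_emod_eq_zero (Int.emod_eq_emod_iff_emod_sub_eq_zero.mp hxy)
    have h2 := Int.eq_zero_of_abs_lt_dvd (h.dvd_of_dvd_mul_right h1) (by rw [abs_lt]; omega)
    omega
  exact Finset.sum_nbij _ hmaps hinj
    (Finset.surjOn_of_injOn_of_card_le _ hmaps hinj le_rfl) (fun _ _ => rfl)

/-- Lemma 2.3 (3): for `a ≥ 2`, `r ≥ 1` with `gcd(a,r) = 1`,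
`6a·∑_{l=1}^{a−1} ⌊lr/a⌋² ≥ (r−1)²(a−1)(2a−1)`. -/
theorem lemma_floor_square_sum (a r : ℤ) (ha : 2 ≤ a) (hr : 1 ≤ r) (hgcd : Int.gcd a r = 1) :
    6 * a * (∑ l ∈ Finset.Icc (1 : ℤ) (a - 1), (⌊((l : ℚ) * (r : ℚ)) / (a : ℚ)⌋) ^ 2) ≥
      (r - 1) ^ 2 * (a - 1) * (2 * a - 1) := by
  have hfloor (l : ℤ) : ⌊((l : ℚ) * (r : ℚ)) / (a : ℚ)⌋ = l * r / a := by
    lift a to ℕ using by omega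
    exact_mod_cast Rat.floor_intCast_div_natCast (l * r) a
  simp only [hfloor]
  have hS := six_mul_sum_Icc_sq a (by omega)
  have hP := sum_Icc_mul_emod a r (by omega) (Int.isCoprime_iff_gcd_eq_one.mpr hgcd) (· ^ 2)
  have key : ∑ l ∈ Finset.Icc (1 : ℤ) (a - 1), ((r ^ 2 - r) * l ^ 2 + (1 - r) * (l * r % a) ^ 2) ≤
      ∑ l ∈ Finset.Icc (1 : ℤ) (a - 1), a ^ 2 * (l * r / a) ^ 2 := by
    refine Finset.sum_le_sum fun l _ => ?_
    have h1 : a * (l * r / a) = l * r - l * r % a := by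
      have := Int.emod_add_mul_ediv (l * r) a
      omega
    rw [← mul_pow, h1]
    nlinarith [mul_nonneg (show 0 ≤ r by omega) (sq_nonneg (l - l * r % a))]
  rw [Finset.sum_add_distrib, ← Finset.mul_sum, ← Finset.mul_sum, ← Finset.mul_sum, hP] at key
  refine le_of_mul_le_mul_left ?_ (show 0 < a by omega)
  linear_combination 6 * key - (r - 1) ^ 2 * hS
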